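/- arXiv:2112.15041 — 4 statements merged into one kernel-verified Lean document; each statement's English description precedes it below -/
import Mathlib

section
/- Assume Setup (T). Then p^m · (P∗(P∗P)) = P ∗ (P ∗ P^{p^m}), where P^{p^m} is the p^m-th power of P in (A,∘). -/
/-- A (left) brace: an abelian group `(A,+)` and a group `(A,∘)` (written `*`)
on the same underlying set, with `a∘(b+c)+a = a∘b+a∘c`; the identity of `(A,∘)`
coincides with `0`. -/
class Brace (A : Type*) extends AddCommGroup A, Group A where
  mul_add_left : ∀ a b c : A, a * (b + c) + a = a * b + a * c
  one_eq_zero : (1 : A) = 0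

namespace Brace

variable {A : Type*} [Brace A]

/-- The star operation `a ∗ b = a∘b - a - b`. -/
def bstar (a b : A) : A := a * b - a - b

/-- `X ∗ Y`: the additive subgroup generated by `{x∗y : x ∈ X, y ∈ Y}`. -/
def starSpan (A : Type*) [Brace A] (X Y : Set A) : AddSubgroup A :=
  AddSubgroup.closure {z : A | ∃ x ∈ X, ∃ y ∈ Y, z = bstar x y}

/-- `A² = A ∗ A`. -/
def sq (A : Type*) [Brace A] : AddSubgroup A := starSpan A Set.univ Set.univ

/-- `A³ = A ∗ A²`. -/
def cube (A : Type*) [Brace A] : AddSubgroup A := starSpan A Set.univ (sq A : Set A)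

/-- The right series: `rightSeries A 0 = A^(1) = A`, `rightSeries A (n+1) = A^(n+1+1) = A^(n+1) ∗ A`. -/
def rightSeries (A : Type*) [Brace A] : ℕ → AddSubgroup A
  | 0 => ⊤
  | n + 1 => starSpan A (rightSeries A n : Set A) Set.univ

/-- A brace is right nilpotent if `A^(n) = 0` for some `n`. -/
def RightNilpotent (A : Type*) [Brace A] : Prop := ∃ n : ℕ, rightSeries A n = ⊥

/-- `c ∈ Z(A)`: `c∗a = a∗c` for all `a`. -/
def IsCentral (c : A) : Prop := ∀ a : A, bstar c a = bstar a c

end Brace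

/-- Setup (T) of the paper: `p > 5` prime, `A` a brace of cardinality `p^4` whose additive
group is `C_p × C_{p^3}` (with `m = 2`) or `C_{p^2} × C_{p^2}` (with `m = 1`), whose
multiplicative group is generated by `{P, Q_1, …, Q_i}`, with `P^{p^m}` central and in `A²`,
each `Q_j` of order at most `p^m`, and every `a ∈ A` writable as
`P^k ∘ Q_{σ(1)}^{a_{σ(1)}} ∘ ⋯ ∘ Q_{σ(i)}^{a_{σ(i)}}` for every ordering `σ`. -/
structure SetupT (p m i : ℕ) (A : Type*) [Brace A] (P : A) (Q : Fin i → A) : Prop where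
  hp : p.Prime
  hp5 : 5 < p
  hcard : Nat.card A = p ^ 4
  hadd : (Nonempty (A ≃+ ZMod p × ZMod (p ^ 3)) ∧ m = 2) ∨
         (Nonempty (A ≃+ ZMod (p ^ 2) × ZMod (p ^ 2)) ∧ m = 1)
  hgen : Subgroup.closure ({P} ∪ Set.range Q) = ⊤
  hcentral : Brace.IsCentral (P ^ (p ^ m))
  hsq : P ^ (p ^ m) ∈ Brace.sq A
  hord : ∀ j : Fin i, orderOf (Q j) ≤ p ^ m
  hdecomp : ∀ a : A, ∀ σ : Equiv.Perm (Fin i), ∃ (k : ℤ) (e : Fin i → ℤ),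
      a = P ^ k * (List.ofFn fun t : Fin i => Q (σ t) ^ e (σ t)).prod

theorem addMonoidEnd_mul_apply {A : Type*} [AddZeroClass A] (f g : AddMonoid.End A) (x : A) :
    (f * g) x = f (g x) := rfl

namespace Brace

variable {A : Type*} [Brace A]

/-- The additive endomorphism `b ↦ a∘b - a`. -/
def lambdaHom (a : A) : AddMonoid.End A :=
  AddMonoidHom.mk' (fun b => a * b - a) fun b c => by
    have h := mul_add_left a b c
    rw [← eq_sub_iff_add_eq] at h
    rw [h]
    abel

theorem lambdaHom_apply (a b : A) : lambdaHom a b = a * b - a := rfl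

/-- The additive endomorphism `b ↦ a ∗ b`. -/
def starHom (a : A) : AddMonoid.End A := lambdaHom a - 1

theorem starHom_apply (a b : A) : starHom a b = bstar a b := rfl

theorem lambdaHom_pow_apply (a b : A) (k : ℕ) :
    (lambdaHom a ^ k) b = a ^ k * b - a ^ k := by
  induction k with
  | zero => simp [one_eq_zero]
  | succ k ih =>
    rw [pow_succ', addMonoidEnd_mul_apply, ih, map_sub, lambdaHom_apply, lambdaHom_apply,
      pow_succ', mul_assoc]
    abel

theorem lambdaHom_pow_card (a : A) : lambdaHom a ^ Nat.card A = 1 := by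
  ext b
  rw [lambdaHom_pow_apply, pow_card_eq_one', one_mul, one_eq_zero, sub_zero]
  rfl

theorem mul_eq_add_add_starHom (a b : A) : a * b = a + b + starHom a b := by
  rw [starHom_apply, bstar]
  abel

/-- If `a ∗ (a ∗ (a ∗ (a ∗ x))) = 0` for all `x`, then
`a ∗ (a ∗ aⁿ)` has a binomial expansion with two terms. -/
theorem starHom_starHom_pow (a : A) (h : starHom a ^ 4 = 0) (n : ℕ) :
    (starHom a ^ 2) (a ^ n) = n • (starHom a ^ 2) a + n.choose 2 • (starHom a ^ 3) a := by
  induction n with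
  | zero => simp [one_eq_zero]
  | succ n ih =>
    have h3 : (starHom a ^ 2) (starHom a (a ^ n)) = n • (starHom a ^ 3) a := by
      have h4 : (starHom a) ((starHom a ^ 3) a) = 0 := by
        rw [← addMonoidEnd_mul_apply, ← pow_succ', h]
        rfl
      rw [← addMonoidEnd_mul_apply, ← pow_succ, pow_succ', addMonoidEnd_mul_apply, ih, map_add,
        map_nsmul, map_nsmul, h4, smul_zero, add_zero, ← addMonoidEnd_mul_apply, ← pow_succ']
    rw [pow_succ' a, mul_eq_add_add_starHom, map_add, map_add, h3, ih, Nat.choose_succ_succ' n 1,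
      Nat.choose_one_right]
    module

end Brace

section PGroup

variable {A : Type*} [AddCommGroup A] {p n : ℕ}

/-- A unipotent endomorphism of `p`-power order of a finite abelian `p`-group
differs from the identity by a nilpotent endomorphism. -/
theorem isNilpotent_of_add_one_pow_eq_one (hp : p.Prime) (hA : Nat.card A = p ^ n)
    (D : AddMonoid.End A) {N : ℕ} (h : (D + 1) ^ p ^ N = 1) : IsNilpotent D := by
  obtain ⟨r, hr⟩ : ∃ r : AddMonoid.End A, D ^ p ^ N = (p : AddMonoid.End A) * r := by
    obtain ⟨r, hr⟩ := (Commute.one_right D).exists_add_pow_prime_pow_eq hp N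
    rw [h, one_pow] at hr
    refine ⟨-(D * 1 * r), ?_⟩
    have h0 : D ^ p ^ N + (p : AddMonoid.End A) * (D * 1 * r) = 0 := by
      have h1 : D ^ p ^ N + (p : AddMonoid.End A) * (D * 1 * r) + 1 = 0 + 1 := by
        rw [zero_add]
        nth_rewrite 3 [hr]
        simp only [mul_assoc]
        abel
      exact add_right_cancel h1
    rw [mul_neg]
    exact eq_neg_of_add_eq_zero_left h0
  have hpn : (p : AddMonoid.End A) ^ n = 0 := by
    ext x
    rw [← Nat.cast_pow, ← hA, AddMonoid.End.natCast_apply, card_nsmul_eq_zero']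
    rfl
  refine ⟨p ^ N * n, ?_⟩
  rw [pow_mul, hr, (Nat.cast_commute p r).mul_pow, hpn, zero_mul]

/-- The orders of the images of the powers of a nilpotent endomorphism of
a finite abelian `p`-group drop by a factor `p` at each step. -/
theorem card_range_pow_dvd (hp : p.Prime) (hA : Nat.card A = p ^ n)
    {D : AddMonoid.End A} (hD : IsNilpotent D) (k : ℕ) :
    Nat.card (AddMonoidHom.range (D ^ k)) ∣ p ^ (n - k) := by
  have : Finite A := Nat.finite_of_card_ne_zero (hA ▸ pow_ne_zero _ hp.ne_zero)
  induction k with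
  | zero =>
    rw [Nat.sub_zero, ← hA]
    exact AddSubgroup.card_addSubgroup_dvd_card _
  | succ k ih =>
    have hle : AddMonoidHom.range (D ^ (k + 1)) ≤ AddMonoidHom.range (D ^ k) := by
      rintro _ ⟨x, rfl⟩
      exact ⟨D x, by rw [pow_succ]; rfl⟩
    by_cases heq : AddMonoidHom.range (D ^ (k + 1)) = AddMonoidHom.range (D ^ k)
    · have hconst : ∀ j, AddMonoidHom.range (D ^ (k + j)) = AddMonoidHom.range (D ^ k) := by
        intro j
        induction j with
        | zero => rfl
        | succ j ihj =>
          rw [← heq]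
          refine le_antisymm ?_ ?_
          · rintro _ ⟨x, rfl⟩
            have hpow : D ^ (k + 1) * D ^ j = D ^ (k + (j + 1)) := by
              rw [← pow_add, add_assoc, add_comm 1 j]
            exact ⟨(D ^ j) x, DFunLike.congr_fun hpow x⟩
          · rintro _ ⟨x, rfl⟩
            have hx : (D ^ k) x ∈ AddMonoidHom.range (D ^ (k + j)) := ihj ▸ ⟨x, rfl⟩
            obtain ⟨y, hy⟩ := hx
            refine ⟨y, ?_⟩
            rw [← add_assoc, pow_succ', pow_succ']
            exact congrArg D hy
      obtain ⟨N, hN⟩ := hD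
      have hbot : AddMonoidHom.range (D ^ (k + 1)) = ⊥ := by
        rw [heq, ← hconst N, pow_add, hN, mul_zero]
        exact AddMonoidHom.range_zero
      rw [hbot, AddSubgroup.card_bot]
      exact one_dvd _
    · have hd := AddSubgroup.card_dvd_of_le hle
      obtain ⟨a, ha, hca⟩ := (Nat.dvd_prime_pow hp).1 ih
      rw [hca] at hd
      obtain ⟨b, hb, hcb⟩ := (Nat.dvd_prime_pow hp).1 hd
      have hne : b ≠ a := fun hab => heq <| AddSubgroup.eq_of_le_of_card_ge hle <| by
        rw [hca, hcb, hab]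
      rw [hcb]
      exact pow_dvd_pow p (by omega)

end PGroup

/-- under Setup (T), p^m·(P∗(P∗P)) = P∗(P∗P^{p^m}). -/
theorem setupT_pm_star_star (p m i : ℕ) (A : Type*) [Brace A]
    (P : A) (Q : Fin i → A) (h : SetupT p m i A P Q) :
    (p ^ m) • Brace.bstar P (Brace.bstar P P) =
      Brace.bstar P (Brace.bstar P (P ^ (p ^ m))) := by
  have hp := h.hp
  have hD : IsNilpotent (Brace.starHom P) := by
    refine isNilpotent_of_add_one_pow_eq_one hp h.hcard _ (N := 4) ?_
    rw [Brace.starHom, sub_add_cancel, ← h.hcard, Brace.lambdaHom_pow_card]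
  have hcard := card_range_pow_dvd hp h.hcard hD
  have h4 : Brace.starHom P ^ 4 = 0 := by
    have hbot : AddMonoidHom.range (Brace.starHom P ^ 4) = ⊥ :=
      AddSubgroup.eq_bot_of_card_eq _ (Nat.dvd_one.1 (hcard 4))
    exact AddMonoidHom.range_eq_bot_iff.1 hbot
  have h3 : p • (Brace.starHom P ^ 3) P = 0 := by
    have hx : (Brace.starHom P ^ 3) P ∈ AddMonoidHom.range (Brace.starHom P ^ 3) := ⟨P, rfl⟩
    have hord := (AddSubgroup.addOrderOf_dvd_natCard _ hx).trans (hcard 3)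
    exact addOrderOf_dvd_iff_nsmul_eq_zero.1 (by simpa only [Nat.reduceSub, pow_one] using hord)
  have hm : m ≠ 0 := by
    rcases h.hadd with ⟨-, h2⟩ | ⟨-, h1⟩ <;> omega
  have hdvd : p ∣ (p ^ m).choose 2 := by
    have h5 := h.hp5
    have hle := Nat.le_self_pow hm p
    exact hp.dvd_choose_pow two_ne_zero (by omega)
  have key := Brace.starHom_starHom_pow P h4 (p ^ m)
  obtain ⟨c, hc⟩ := hdvd
  rw [hc, mul_comm, mul_smul, h3, smul_zero, add_zero] at key
  exact key.symm
end

section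
/- Let A be a brace. Then for all a, b ∈ A, the commutator a^{-1} ∘ b^{-1} ∘ a ∘ b (inverses and products taken in the group (A,∘)) lies in A², the additive subgroup generated by {x∗y : x, y ∈ A}. -/
namespace Brace

theorem bstar_mem_sq {A : Type*} [Brace A] (a b : A) : bstar a b ∈ sq A :=
  AddSubgroup.subset_closure ⟨a, Set.mem_univ a, b, Set.mem_univ b, rfl⟩

/-- The quotient map by `A²`, as a homomorphism from `(A,∘)` to the additive group `A / A²`. -/
def mulToQuotientSq (A : Type*) [Brace A] : A →* Multiplicative (A ⧸ sq A) :=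
  MonoidHom.mk' (fun a => Multiplicative.ofAdd (a : A ⧸ sq A)) fun a b => by
    rw [← ofAdd_add, ← QuotientAddGroup.mk_add]
    congr 1
    rw [eq_comm, QuotientAddGroup.eq]
    have h := bstar_mem_sq a b
    rwa [bstar, show a * b - a - b = -(a + b) + a * b by abel] at h

theorem mulToQuotientSq_eq_one_iff {A : Type*} [Brace A] (a : A) :
    mulToQuotientSq A a = 1 ↔ a ∈ sq A :=
  QuotientAddGroup.eq_zero_iff a

end Brace

/-- in any brace, commutators a⁻¹∘b⁻¹∘a∘b lie in A². -/
theorem commutator_mem_sq (A : Type*) [Brace A] (a b : A) :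
    a⁻¹ * b⁻¹ * a * b ∈ Brace.sq A := by
  rw [← Brace.mulToQuotientSq_eq_one_iff]
  simp only [map_mul, map_inv]
  rw [mul_right_comm, inv_mul_cancel_right, inv_mul_cancel]
end

section
/- Let p > 5 be prime and let A be a brace of cardinality p^4 with (A,+) ≅ C_{p^2} × C_{p^2}, whose group (A,∘) is generated by elements P, Q satisfying P^{p^2} = Q^{p^2} = 1 and Q^{-1}∘P∘Q = P^{1+p}, and such that P^p ∈ p·A and Q^p ∈ p·A. Then p·A ⊆ Z(A), i.e. every element of the subgroup p·A = {p·a : a ∈ A} is a central element of the brace A. -/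
namespace Brace

/-- The additive endomorphism `b ↦ a∘b - a` attached to `a`. -/
def lambda {A : Type*} [Brace A] (a : A) : A →+ A :=
  AddMonoidHom.mk' (fun b => a * b - a) fun b c => by
    rw [eq_sub_of_add_eq (mul_add_left a b c)]
    abel

theorem mul_eq_add_lambda {A : Type*} [Brace A] (a b : A) : a * b = a + lambda a b := by
  simp [lambda]

theorem inv_eq_neg_lambda {A : Type*} [Brace A] (a : A) : a⁻¹ = -lambda a⁻¹ a := by
  simp [lambda, one_eq_zero]

/-- The multiples `n·A` form a subgroup of the multiplicative group of a brace. -/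
def nsmulSubgroup (A : Type*) [Brace A] (n : ℕ) : Subgroup A where
  carrier := {x | ∃ a : A, x = n • a}
  one_mem' := ⟨0, by rw [one_eq_zero, nsmul_zero]⟩
  mul_mem' := by
    rintro _ _ ⟨a, rfl⟩ ⟨b, rfl⟩
    exact ⟨a + lambda (n • a) b, by rw [mul_eq_add_lambda, map_nsmul, nsmul_add]⟩
  inv_mem' := by
    rintro _ ⟨a, rfl⟩
    exact ⟨-lambda (n • a)⁻¹ a, by rw [smul_neg, ← map_nsmul]; exact inv_eq_neg_lambda _⟩

theorem isCentral_of_mem_center {A : Type*} [Brace A] {c : A} (hc : c ∈ Subgroup.center A) :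
    IsCentral c := fun a => by
  rw [bstar, bstar, Subgroup.mem_center_iff.mp hc a]
  abel

end Brace

theorem ZMod.exists_fin_nsmul_eq (p : ℕ) [NeZero p] (u : ZMod (p ^ 2)) :
    ∃ i : Fin p, p • u = ((p * i : ℕ) : ZMod (p ^ 2)) := by
  refine ⟨⟨u.val % p, Nat.mod_lt _ (NeZero.pos p)⟩, ?_⟩
  conv_lhs => rw [← ZMod.natCast_zmod_val u, nsmul_eq_mul, ← Nat.cast_mul]
  rw [ZMod.natCast_eq_natCast_iff]
  simpa [pow_two] using ((Nat.mod_modEq u.val p).symm).mul_left' p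

theorem card_range_nsmul_le (p : ℕ) [NeZero p] {A : Type*} [AddCommGroup A]
    (e : A ≃+ ZMod (p ^ 2) × ZMod (p ^ 2)) :
    Nat.card {x : A | ∃ a : A, x = p • a} ≤ p ^ 2 := by
  let f : Fin p × Fin p → A := fun ij => e.symm ((p * ij.1 : ℕ), (p * ij.2 : ℕ))
  have hsub : {x : A | ∃ a : A, x = p • a} ⊆ Set.range f := by
    rintro _ ⟨a, rfl⟩
    obtain ⟨i, hi⟩ := ZMod.exists_fin_nsmul_eq p (e a).1
    obtain ⟨j, hj⟩ := ZMod.exists_fin_nsmul_eq p (e a).2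
    refine ⟨(i, j), ?_⟩
    rw [AddEquiv.symm_apply_eq, map_nsmul]
    exact Prod.ext hi.symm hj.symm
  calc Nat.card {x : A | ∃ a : A, x = p • a}
      ≤ Nat.card (Set.range f) := Nat.card_mono (Set.finite_range f) hsub
    _ ≤ Nat.card (Fin p × Fin p) := Finite.card_range_le f
    _ = p ^ 2 := by simp [pow_two]

theorem card_le_of_closure_commuting_pair {G : Type*} [Group G] (p : ℕ) [NeZero p] {x y : G}
    (hgen : Subgroup.closure ({x, y} : Set G) = ⊤) (hxy : Commute x y)
    (hx : x ^ p = 1) (hy : y ^ p = 1) : Nat.card G ≤ p ^ 2 := by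
  have hmod (z : G) (hz : z ^ p = 1) (i : ℤ) : ∃ k : Fin p, z ^ i = z ^ (k : ℕ) := by
    have hp : (p : ℤ) ≠ 0 := by exact_mod_cast NeZero.ne p
    have hi := Int.emod_nonneg i hp
    have hlt := Int.emod_lt_of_pos i (by have := NeZero.pos p; omega : (0 : ℤ) < p)
    refine ⟨⟨(i % p).toNat, by omega⟩, ?_⟩
    rw [← zpow_natCast, Int.toNat_of_nonneg hi]
    conv_lhs => rw [← Int.emod_add_mul_ediv i p, zpow_add, zpow_mul, zpow_natCast, hz, one_zpow,
      mul_one]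
  have hzpow (g : G) : ∃ i j : ℤ, g = x ^ i * y ^ j := by
    have hg : g ∈ Subgroup.closure ({x, y} : Set G) := hgen ▸ Subgroup.mem_top g
    induction hg using Subgroup.closure_induction with
    | mem g hg =>
      rcases hg with rfl | rfl
      · exact ⟨1, 0, by simp⟩
      · exact ⟨0, 1, by simp⟩
    | one => exact ⟨0, 0, by simp⟩
    | mul _ _ _ _ ha hb =>
      obtain ⟨i, j, rfl⟩ := ha
      obtain ⟨k, l, rfl⟩ := hb
      refine ⟨i + k, j + l, ?_⟩
      rw [zpow_add, zpow_add, mul_assoc, mul_assoc, ← mul_assoc (y ^ j),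
        ((hxy.zpow_zpow k j).eq).symm, mul_assoc]
    | inv _ _ ha =>
      obtain ⟨i, j, rfl⟩ := ha
      exact ⟨-i, -j, by rw [mul_inv_rev, zpow_neg, zpow_neg, (hxy.zpow_zpow i j).inv_inv.eq]⟩
  have hsurj : Function.Surjective
      (fun ij : Fin p × Fin p => x ^ (ij.1 : ℕ) * y ^ (ij.2 : ℕ)) := fun g => by
    obtain ⟨i, j, rfl⟩ := hzpow g
    obtain ⟨k, hk⟩ := hmod x hx i
    obtain ⟨l, hl⟩ := hmod y hy j
    exact ⟨(k, l), by rw [hk, hl]⟩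
  simpa [pow_two] using Nat.card_le_card_of_surjective _ hsurj

theorem mem_center_of_commute_generators {G : Type*} [Group G] {x y z : G}
    (hgen : Subgroup.closure ({x, y} : Set G) = ⊤) (hx : Commute z x) (hy : Commute z y) :
    z ∈ Subgroup.center G := by
  have hle : Subgroup.closure ({x, y} : Set G) ≤ Subgroup.centralizer {z} := by
    rw [Subgroup.closure_le]
    rintro _ (rfl | rfl)
    · exact Subgroup.mem_centralizer_singleton_iff.mpr hx.eq.symm
    · exact Subgroup.mem_centralizer_singleton_iff.mpr hy.eq.symm
  rw [hgen] at hle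
  exact Subgroup.mem_center_iff.mpr fun g =>
    Subgroup.mem_centralizer_singleton_iff.mp (hle (Subgroup.mem_top g))

theorem pow_mem_center_of_conj {G : Type*} [Group G] {p : ℕ} {x y : G}
    (hgen : Subgroup.closure ({x, y} : Set G) = ⊤) (hx : x ^ p ^ 2 = 1)
    (hconj : y⁻¹ * x * y = x ^ (1 + p)) :
    x ^ p ∈ Subgroup.center G ∧ y ^ p ∈ Subgroup.center G := by
  have hxp : Commute (x ^ p) y := by
    have h : y⁻¹ * x ^ p * y = x ^ p := by
      calc y⁻¹ * x ^ p * y = (y⁻¹ * x * y) ^ p := by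
            simpa using (conj_pow (a := y⁻¹) (b := x) (i := p)).symm
        _ = x ^ p * x ^ p ^ 2 := by rw [hconj, ← pow_mul, ← pow_add]; ring_nf
        _ = x ^ p := by rw [hx, mul_one]
    rw [mul_assoc, inv_mul_eq_iff_eq_mul] at h
    exact h
  have hstep : x * y = y * x * x ^ p := by
    rw [mul_assoc, inv_mul_eq_iff_eq_mul, pow_add, pow_one] at hconj
    rw [hconj, mul_assoc]
  have hpow (n : ℕ) : x * y ^ n = y ^ n * x * (x ^ p) ^ n := by
    induction n with
    | zero => simp
    | succ n ih =>
      calc x * y ^ (n + 1) = y ^ n * x * ((x ^ p) ^ n * y) := by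
            rw [pow_succ, ← mul_assoc, ih, mul_assoc]
        _ = y ^ n * (x * y) * (x ^ p) ^ n := by rw [(hxp.pow_left n).eq]; group
        _ = y ^ (n + 1) * x * (x ^ p) ^ (n + 1) := by
            rw [hstep, pow_succ, pow_succ' (x ^ p)]; simp only [mul_assoc]
  refine ⟨mem_center_of_commute_generators hgen (Commute.pow_self x p) hxp,
    mem_center_of_commute_generators hgen ?_ (Commute.pow_self y p)⟩
  have h := hpow p
  rw [← pow_mul, ← pow_two, hx, mul_one] at h
  exact h.symm

theorem card_le_mul_card_closure_pow {G : Type*} [Group G] {p : ℕ} [NeZero p] {x y : G}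
    (hgen : Subgroup.closure ({x, y} : Set G) = ⊤)
    (hconj : y⁻¹ * x * y = x ^ (1 + p))
    (hcenter : Subgroup.closure ({x ^ p, y ^ p} : Set G) ≤ Subgroup.center G) :
    Nat.card G ≤ p ^ 2 * Nat.card (Subgroup.closure ({x ^ p, y ^ p} : Set G)) := by
  set H := Subgroup.closure ({x ^ p, y ^ p} : Set G)
  have : H.Normal := ⟨fun h hh g => by
    rwa [Subgroup.mem_center_iff.mp (hcenter hh) g, mul_inv_cancel_right]⟩
  let π := QuotientGroup.mk' H
  have hx : π x ^ p = 1 := by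
    rw [← map_pow]
    exact (QuotientGroup.eq_one_iff _).mpr (Subgroup.subset_closure (by simp))
  have hy : π y ^ p = 1 := by
    rw [← map_pow]
    exact (QuotientGroup.eq_one_iff _).mpr (Subgroup.subset_closure (by simp))
  have hxy : Commute (π x) (π y) := by
    have h := congrArg π hconj
    rw [map_mul, map_mul, map_inv, map_pow, pow_add, hx, mul_one, pow_one, mul_assoc,
      inv_mul_eq_iff_eq_mul] at h
    exact h
  have hπ : Subgroup.closure ({π x, π y} : Set (G ⧸ H)) = ⊤ := by
    rw [← Set.image_pair, ← MonoidHom.map_closure, hgen,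
      Subgroup.map_top_of_surjective _ (QuotientGroup.mk'_surjective H)]
  rw [Subgroup.card_eq_card_quotient_mul_card_subgroup H]
  exact Nat.mul_le_mul_right _ (card_le_of_closure_commuting_pair p hπ hxy hx hy)

/-- in a brace of cardinality p^4 with additive group C_{p^2} × C_{p^2}
and multiplicative group VIII, if P^p, Q^p ∈ pA then pA ⊆ Z(A). -/
theorem braceVIII_pA_central (p : ℕ) (hp : p.Prime) (hp5 : 5 < p)
    (A : Type*) [Brace A] (hcard : Nat.card A = p ^ 4)
    (hadd : Nonempty (A ≃+ ZMod (p ^ 2) × ZMod (p ^ 2)))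
    (P Q : A) (hgen : Subgroup.closure ({P, Q} : Set A) = ⊤)
    (hP : P ^ (p ^ 2) = 1) (hQ : Q ^ (p ^ 2) = 1)
    (hQP : Q⁻¹ * P * Q = P ^ (1 + p))
    (hPp : ∃ a : A, P ^ p = p • a) (hQp : ∃ a : A, Q ^ p = p • a) :
    ∀ x : A, (∃ a : A, x = p • a) → Brace.IsCentral x := by 
  have : NeZero p := ⟨hp.ne_zero⟩
  have : Finite A := Nat.finite_of_card_ne_zero (by rw [hcard]; exact pow_ne_zero _ hp.ne_zero)
  obtain ⟨e⟩ := hadd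
  obtain ⟨hPc, hQc⟩ := pow_mem_center_of_conj hgen hP hQP
  have hcenter : Subgroup.closure ({P ^ p, Q ^ p} : Set A) ≤ Subgroup.center A := by
    rw [Subgroup.closure_le]
    rintro _ (rfl | rfl) <;> assumption
  have hle : Subgroup.closure ({P ^ p, Q ^ p} : Set A) ≤ Brace.nsmulSubgroup A p := by
    rw [Subgroup.closure_le]
    rintro _ (rfl | rfl) <;> assumption
  have hlower : p ^ 2 ≤ Nat.card (Subgroup.closure ({P ^ p, Q ^ p} : Set A)) := by
    have h := card_le_mul_card_closure_pow hgen hQP hcenter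
    rw [hcard, show p ^ 4 = p ^ 2 * p ^ 2 by ring] at h
    exact Nat.le_of_mul_le_mul_left h (pow_pos hp.pos 2)
  have hupper : Nat.card (Brace.nsmulSubgroup A p) ≤ p ^ 2 := card_range_nsmul_le p e
  have heq := Subgroup.eq_of_le_of_card_ge hle (hupper.trans hlower)
  intro x hx
  have hmem : x ∈ Brace.nsmulSubgroup A p := hx
  rw [← heq] at hmem
  exact Brace.isCentral_of_mem_center (hcenter hmem)
end

section
/- Let p > 5 be prime and let A be a brace of cardinality p^4 with (A,+) ≅ C_{p^2} × C_{p^2}, whose group (A,∘) is generated by elements P, Q satisfying P^{p^2} = Q^{p^2} = 1 and Q^{-1}∘P∘Q = P^{1+p} (powers and inverses in (A,∘)). Then A is right nilpotent. -/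
namespace Brace

variable {A : Type*} [Brace A]

/-- The action `a ↦ λ_a` of `(A,∘)` on `(A,+)`, where `λ_a b = a∘b - a`. -/
def lam (a : A) : A →+ A :=
  AddMonoidHom.mk' (fun b => a * b - a) fun b c => by
    rw [eq_sub_of_add_eq (mul_add_left a b c)]; abel

lemma lam_apply (a b : A) : lam a b = a * b - a := rfl

lemma mul_eq_add_lam (a b : A) : a * b = a + lam a b := by rw [lam_apply]; abel

lemma bstar_eq_lam_sub (a b : A) : bstar a b = lam a b - b := rfl

lemma lam_eq_add_bstar (a b : A) : lam a b = b + bstar a b := by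
  rw [bstar_eq_lam_sub]; abel

lemma lam_one (b : A) : lam 1 b = b := by
  rw [lam_apply, one_mul, one_eq_zero, sub_zero]

lemma lam_mul (a b c : A) : lam (a * b) c = lam a (lam b c) := by
  have h : a * b * c = a * (b * c) := mul_assoc a b c
  rw [mul_eq_add_lam, mul_eq_add_lam b c, mul_eq_add_lam a (b + lam b c), mul_eq_add_lam a b,
    map_add, ← add_assoc] at h
  rw [mul_eq_add_lam a b]
  exact add_left_cancel h

lemma bstar_add (a b c : A) : bstar a (b + c) = bstar a b + bstar a c := by
  simp only [bstar_eq_lam_sub, map_add]; abel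

lemma bstar_nsmul (n : ℕ) (a b : A) : bstar a (n • b) = n • bstar a b := by
  simp only [bstar_eq_lam_sub, map_nsmul, nsmul_sub]

lemma bstar_comm_of_commute {a b : A} (h : Commute a b) : bstar a b = bstar b a := by
  simp only [bstar, h.eq]; abel

lemma starSpan_le {X Y : Set A} {N : AddSubgroup A} (h : ∀ x ∈ X, ∀ y ∈ Y, bstar x y ∈ N) :
    starSpan A X Y ≤ N := by
  rw [starSpan, AddSubgroup.closure_le]
  rintro z ⟨x, hx, y, hy, rfl⟩
  exact h x hx y hy

/-- `N` is a left ideal: an additive subgroup stable under all `λ_a`. -/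
def LamStable (N : AddSubgroup A) : Prop := ∀ a : A, ∀ x ∈ N, lam a x ∈ N

lemma LamStable.bstar_mem {N : AddSubgroup A} (hN : LamStable N) (a : A) {x : A} (hx : x ∈ N) :
    bstar a x ∈ N :=
  N.sub_mem (hN a x hx) hx

/-- The elements of `A` whose classes modulo `N` are fixed by all `λ_a`. -/
def fixedMod (N : AddSubgroup A) : AddSubgroup A where
  carrier := {x | ∀ a : A, bstar a x ∈ N}
  zero_mem' a := by simp [bstar_eq_lam_sub]
  add_mem' hx hy a := by rw [bstar_add]; exact N.add_mem (hx a) (hy a)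
  neg_mem' {x} hx a := by
    have h : bstar a (-x) = -bstar a x := by simp only [bstar_eq_lam_sub, map_neg]; abel
    rw [h]; exact N.neg_mem (hx a)

lemma LamStable.le_fixedMod {N : AddSubgroup A} (hN : LamStable N) : N ≤ fixedMod N :=
  fun _ hx a => hN.bstar_mem a hx

lemma LamStable.fixedMod {N : AddSubgroup A} (hN : LamStable N) : LamStable (fixedMod N) := by
  intro a x hx
  rw [lam_eq_add_bstar]
  exact (Brace.fixedMod N).add_mem hx (hN.le_fixedMod (hx a))

/-- The action of `(A,∘)` on `A/N` induced by `λ`. -/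
abbrev LamStable.quotientAction {N : AddSubgroup A} (hN : LamStable N) : MulAction A (A ⧸ N) where
  smul a := QuotientAddGroup.map N N (lam a) (hN a)
  one_smul x := by
    induction x using QuotientAddGroup.induction_on with
    | H x => exact congrArg _ (lam_one x)
  mul_smul a b x := by
    induction x using QuotientAddGroup.induction_on with
    | H x => exact congrArg _ (lam_mul a b x)

lemma LamStable.lt_fixedMod [Finite A] {p n : ℕ} (hp : p.Prime) (hcard : Nat.card A = p ^ n)
    {N : AddSubgroup A} (hN : LamStable N) (hN' : N ≠ ⊤) : N < Brace.fixedMod N := by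
  have := Fact.mk hp
  let := hN.quotientAction
  have hG : IsPGroup p A := IsPGroup.of_card hcard
  have hdvd : p ∣ Nat.card (A ⧸ N) := by
    have h1 : Nat.card (A ⧸ N) ∣ p ^ n := hcard ▸ N.index_dvd_card
    obtain ⟨k, -, hk⟩ := (Nat.dvd_prime_pow hp).1 h1
    have hk0 : k ≠ 0 := by
      rintro rfl
      exact hN' (AddSubgroup.index_eq_one.1 (hk.trans (pow_zero p)))
    rw [hk]
    exact dvd_pow_self p hk0
  obtain ⟨v, hv, hv0⟩ := hG.exists_fixed_point_of_prime_dvd_card_of_fixed_point (A ⧸ N) hdvd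
    (a := 0) (fun a => map_zero (QuotientAddGroup.map N N (lam a) (hN a)))
  obtain ⟨x, rfl⟩ := QuotientAddGroup.mk_surjective v
  refine lt_of_le_of_ne hN.le_fixedMod fun heq => hv0 ?_
  have hx : x ∈ Brace.fixedMod N := fun a => by
    have h : ((lam a x : A) : A ⧸ N) = x := hv a
    have := QuotientAddGroup.eq.1 h.symm
    rwa [neg_add_eq_sub] at this
  exact ((QuotientAddGroup.eq_zero_iff x).2 (heq ▸ hx)).symm

/-- If `A/N` has order at most `p²`, it is left nilpotent of class at most two. -/
lemma LamStable.bstar_mem_fixedMod [Finite A] {p n : ℕ} (hp : p.Prime)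
    (hcard : Nat.card A = p ^ n) {N : AddSubgroup A} (hN : LamStable N) (hidx : N.index ≤ p ^ 2)
    (a b : A) : bstar a b ∈ Brace.fixedMod N := by
  suffices h : Brace.fixedMod (Brace.fixedMod N) = ⊤ by
    have hb : b ∈ Brace.fixedMod (Brace.fixedMod N) := h ▸ AddSubgroup.mem_top b
    exact hb a
  have hstep : ∀ {M : AddSubgroup A}, LamStable M → M ≠ ⊤ →
      p * (Brace.fixedMod M).index ≤ M.index := by
    intro M hM hM'
    have hlt := hM.lt_fixedMod hp hcard hM'
    rw [← AddSubgroup.relIndex_mul_index hlt.le]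
    refine Nat.mul_le_mul_right _ ?_
    have h1 : M.relIndex (Brace.fixedMod M) ∣ p ^ n := by
      rw [← hcard]
      exact (AddSubgroup.relIndex_dvd_index_of_le hlt.le).trans M.index_dvd_card
    obtain ⟨k, -, hk⟩ := (Nat.dvd_prime_pow hp).1 h1
    have hk0 : k ≠ 0 := by
      rintro rfl
      exact hlt.not_ge (AddSubgroup.relIndex_eq_one.1 (by simpa using hk))
    rw [hk]
    exact Nat.le_of_dvd (pow_pos hp.pos k) (dvd_pow_self p hk0)
  by_contra h
  have h1 : Brace.fixedMod N ≠ ⊤ := fun h' => h (top_le_iff.1 (h' ▸ hN.fixedMod.le_fixedMod))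
  have h0 : N ≠ ⊤ := fun h' => h1 (top_le_iff.1 (h' ▸ hN.le_fixedMod))
  have e0 := hstep hN h0
  have e1 := hstep hN.fixedMod h1
  have hlt := hN.fixedMod.fixedMod.lt_fixedMod hp hcard h
  have e2 := hstep hN.fixedMod.fixedMod h
  have e3 : 0 < (Brace.fixedMod (Brace.fixedMod (Brace.fixedMod N))).index :=
    Nat.pos_of_ne_zero AddSubgroup.index_ne_zero_of_finite
  have h3 : p * (p * (p * 1)) ≤ N.index :=
    ((Nat.mul_le_mul_left p ((Nat.mul_le_mul_left p
      ((Nat.mul_le_mul_left p e3).trans e2)).trans e1))).trans e0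
  have h4 : p ^ 2 < p * (p * (p * 1)) := by
    have := hp.one_lt
    have := Nat.mul_lt_mul_of_pos_left this (pow_pos hp.pos 2)
    linarith [this, show p ^ 2 * p = p * (p * (p * 1)) by ring]
  omega

/-- The `p`-th power `a^p` in `(A,∘)` lies in `N` as soon as `pa` and `a∗(a∗a)` do. -/
lemma LamStable.pow_mem {p : ℕ} (hp : p.Prime) (hp2 : p ≠ 2) {N : AddSubgroup A}
    (hN : LamStable N) {a : A} (ha : p • a ∈ N) (haa : bstar a (bstar a a) ∈ N) : a ^ p ∈ N := by
  have key : ∀ n : ℕ, ∃ x ∈ N, a ^ n = n • a + n.choose 2 • bstar a a + x := by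
    intro n
    induction n with
    | zero => exact ⟨0, N.zero_mem, by simp [one_eq_zero]⟩
    | succ n ih =>
      obtain ⟨x, hx, h⟩ := ih
      refine ⟨n.choose 2 • bstar a (bstar a a) + lam a x,
        N.add_mem (N.nsmul_mem haa _) (hN a x hx), ?_⟩
      have hc : (n + 1).choose 2 = n + n.choose 2 := by
        rw [Nat.choose_succ_succ' n 1, Nat.choose_one_right]
      rw [pow_succ', mul_eq_add_lam, h, map_add, map_add, map_nsmul, map_nsmul,
        lam_eq_add_bstar a a, lam_eq_add_bstar a (bstar a a), hc]
      simp only [nsmul_add, add_nsmul, one_nsmul]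
      abel
  obtain ⟨x, hx, h⟩ := key p
  obtain ⟨k, hk⟩ : p ∣ p.choose 2 :=
    hp.dvd_choose_self two_ne_zero (lt_of_le_of_ne hp.two_le (Ne.symm hp2))
  rw [h, hk, mul_comm, mul_nsmul', ← bstar_nsmul]
  exact N.add_mem (N.add_mem ha (N.nsmul_mem (hN.bstar_mem a ha) k)) hx

lemma lamStable_bot : LamStable (⊥ : AddSubgroup A) := by
  rintro a x hx
  rw [AddSubgroup.mem_bot] at hx ⊢
  rw [hx, map_zero]

lemma lamStable_range_nsmul (n : ℕ) : LamStable (nsmulAddMonoidHom (α := A) n).range := by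
  rintro a _ ⟨y, rfl⟩
  exact ⟨lam a y, by simp⟩

lemma LamStable.mul_mem {N : AddSubgroup A} (hN : LamStable N) {x y : A} (hx : x ∈ N)
    (hy : y ∈ N) : x * y ∈ N := by
  rw [mul_eq_add_lam]
  exact N.add_mem hx (hN x y hy)

lemma LamStable.pow_mem_of_mem {N : AddSubgroup A} (hN : LamStable N) {x : A} (hx : x ∈ N)
    (n : ℕ) : x ^ n ∈ N := by
  induction n with
  | zero => rw [pow_zero, one_eq_zero]; exact N.zero_mem
  | succ n ih => rw [pow_succ]; exact hN.mul_mem ih hx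

end Brace

lemma index_range_nsmul_le {A : Type*} [AddCommGroup A] {p : ℕ} (hp : p.Prime)
    (e : A ≃+ ZMod (p ^ 2) × ZMod (p ^ 2)) :
    (nsmulAddMonoidHom (α := A) p).range.index ≤ p ^ 2 := by
  have : NeZero (p ^ 2) := ⟨pow_ne_zero 2 hp.ne_zero⟩
  let f : Fin p × Fin p → A ⧸ (nsmulAddMonoidHom (α := A) p).range :=
    fun ij => ((e.symm ((ij.1 : ℕ), (ij.2 : ℕ)) : A) : A ⧸ (nsmulAddMonoidHom (α := A) p).range)
  have hf : Function.Surjective f := by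
    intro v
    obtain ⟨x, rfl⟩ := QuotientAddGroup.mk_surjective v
    refine ⟨(⟨(e x).1.val % p, Nat.mod_lt _ hp.pos⟩, ⟨(e x).2.val % p, Nat.mod_lt _ hp.pos⟩), ?_⟩
    refine QuotientAddGroup.eq.2 ⟨e.symm (((e x).1.val / p : ℕ), ((e x).2.val / p : ℕ)), ?_⟩
    apply e.injective
    have h : ∀ z : ZMod (p ^ 2), (p : ZMod (p ^ 2)) * ((z.val / p : ℕ) : ZMod (p ^ 2)) =
        -((z.val % p : ℕ) : ZMod (p ^ 2)) + z := by
      intro z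
      rw [eq_neg_add_iff_add_eq]
      conv_rhs => rw [← ZMod.natCast_zmod_val z, ← Nat.mod_add_div z.val p]
      push_cast
      rfl
    ext <;> simp [h]
  have := Nat.card_le_card_of_surjective f hf
  rw [Nat.card_prod, Nat.card_fin, ← sq] at this
  exact this

section GroupVIII

variable {G : Type*} [Group G] {p : ℕ} {P Q : G}

lemma commute_pow_of_conj (hP : P ^ (p ^ 2) = 1) (hQP : Q⁻¹ * P * Q = P ^ (1 + p)) :
    Commute (P ^ p) Q := by
  have h : Q⁻¹ * P ^ p * Q = P ^ p := by
    have h1 : (Q⁻¹ * P * Q⁻¹⁻¹) ^ p = Q⁻¹ * P ^ p * Q⁻¹⁻¹ := conj_pow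
    rw [inv_inv] at h1
    rw [← h1, hQP, ← pow_mul, show (1 + p) * p = p + p ^ 2 by ring, pow_add, hP, mul_one]
  show P ^ p * Q = Q * P ^ p
  nth_rw 2 [← h]
  rw [mul_assoc, mul_inv_cancel_left]

lemma pow_mul_pow_of_conj (hP : P ^ (p ^ 2) = 1) (hQP : Q⁻¹ * P * Q = P ^ (1 + p)) (i j : ℕ) :
    P ^ i * Q ^ j = Q ^ j * P ^ (i + p * (i * j)) := by
  have h1 : P * Q = Q * P ^ (1 + p) := by rw [← hQP]; group
  have hz := commute_pow_of_conj hP hQP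
  have h2 : ∀ i, P ^ i * Q = Q * P ^ (i + p * i) := by
    intro i
    induction i with
    | zero => simp
    | succ i ih =>
      rw [pow_succ, mul_assoc, h1, ← mul_assoc, ih, mul_assoc, ← pow_add]
      congr 2; ring
  induction j with
  | zero => simp
  | succ j ih =>
    rw [pow_succ, ← mul_assoc, ih, mul_assoc, h2, ← mul_assoc]
    have e : i + p * (i * j) + p * (i + p * (i * j)) =
      (i + p * (i * (j + 1))) + p ^ 2 * (i * j) := by ring
    rw [e, pow_add _ _ (p ^ 2 * (i * j)), pow_mul, hP, one_pow, mul_one]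

lemma mul_normal_form (hP : P ^ (p ^ 2) = 1) (hQP : Q⁻¹ * P * Q = P ^ (1 + p)) (i j k l : ℕ) :
    Q ^ j * P ^ i * (Q ^ l * P ^ k) = Q ^ (j + l) * P ^ (i + k + p * (i * l)) := by
  rw [mul_assoc, ← mul_assoc (P ^ i), pow_mul_pow_of_conj hP hQP, mul_assoc (Q ^ l), ← pow_add,
    ← mul_assoc, ← pow_add]
  congr 2; ring

lemma pow_normal_form (hP : P ^ (p ^ 2) = 1) (hQP : Q⁻¹ * P * Q = P ^ (1 + p)) (i j n : ℕ) :
    (Q ^ j * P ^ i) ^ n = Q ^ (j * n) * P ^ (i * n + p * (i * j * n.choose 2)) := by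
  induction n with
  | zero => simp
  | succ n ih =>
    have hc : (n + 1).choose 2 = n + n.choose 2 := by
      rw [Nat.choose_succ_succ' n 1, Nat.choose_one_right]
    rw [pow_succ', ih, mul_normal_form hP hQP, hc]
    congr 2 <;> ring

lemma exists_normal_form [Finite G] (hgen : Subgroup.closure ({P, Q} : Set G) = ⊤)
    (hP : P ^ (p ^ 2) = 1) (hQP : Q⁻¹ * P * Q = P ^ (1 + p)) (g : G) :
    ∃ i j : ℕ, g = Q ^ j * P ^ i := by
  have hg : g ∈ Subgroup.closure ({P, Q} : Set G) := hgen ▸ Subgroup.mem_top g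
  induction hg using Subgroup.closure_induction with
  | mem x hx =>
    rcases hx with rfl | rfl
    · exact ⟨1, 0, by simp⟩
    · exact ⟨0, 1, by simp⟩
  | one => exact ⟨0, 0, by simp⟩
  | mul x y _ _ hx hy =>
    obtain ⟨i, j, rfl⟩ := hx
    obtain ⟨k, l, rfl⟩ := hy
    exact ⟨_, _, mul_normal_form hP hQP i j k l⟩
  | inv x _ hx =>
    obtain ⟨i, j, rfl⟩ := hx
    have h : (Q ^ j * P ^ i)⁻¹ = (Q ^ j * P ^ i) ^ (Nat.card G - 1) := by
      rw [inv_eq_iff_mul_eq_one, ← pow_succ', Nat.sub_add_cancel Nat.card_pos, pow_card_eq_one']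
    exact ⟨_, _, h.trans (pow_normal_form hP hQP i j _)⟩

lemma exists_mul_eq_mul_pow [Finite G] (hp : 0 < p)
    (hgen : Subgroup.closure ({P, Q} : Set G) = ⊤)
    (hP : P ^ (p ^ 2) = 1) (hQP : Q⁻¹ * P * Q = P ^ (1 + p)) (a b : G) :
    ∃ n : ℕ, a * b = b * a * (P ^ p) ^ n := by
  obtain ⟨i, j, rfl⟩ := exists_normal_form hgen hP hQP a
  obtain ⟨k, l, rfl⟩ := exists_normal_form hgen hP hQP b
  refine ⟨i * l + (p - 1) * (k * j), ?_⟩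
  rw [mul_normal_form hP hQP, mul_normal_form hP hQP, ← pow_mul, mul_assoc, ← pow_add,
    add_comm j l]
  obtain ⟨q, rfl⟩ := Nat.exists_eq_succ_of_ne_zero hp.ne'
  have e : k + i + (q + 1) * (k * j) + (q + 1) * (i * l + (q + 1 - 1) * (k * j)) =
      i + k + (q + 1) * (i * l) + (q + 1) ^ 2 * (k * j) := by
    rw [Nat.add_sub_cancel]; ring
  rw [Nat.succ_eq_add_one, e, pow_add _ _ ((q + 1) ^ 2 * (k * j)), pow_mul P ((q + 1) ^ 2), hP,
    one_pow, mul_one]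

lemma dvd_of_normal_form_eq_one [Finite G] (hp : 0 < p) (hcard : Nat.card G = p ^ 4)
    (hgen : Subgroup.closure ({P, Q} : Set G) = ⊤) (hP : P ^ (p ^ 2) = 1)
    (hQ : Q ^ (p ^ 2) = 1) (hQP : Q⁻¹ * P * Q = P ^ (1 + p)) {i j : ℕ}
    (h : Q ^ j * P ^ i = 1) : p ^ 2 ∣ i ∧ p ^ 2 ∣ j := by
  have hpos : 0 < p ^ 2 := pow_pos hp 2
  let f : Fin (p ^ 2) × Fin (p ^ 2) → G := fun x => Q ^ (x.2 : ℕ) * P ^ (x.1 : ℕ)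
  have hf : ∀ i j : ℕ, f (⟨i % p ^ 2, Nat.mod_lt _ hpos⟩, ⟨j % p ^ 2, Nat.mod_lt _ hpos⟩) =
      Q ^ j * P ^ i := by
    intro i j
    simp only [f]
    rw [pow_eq_pow_mod i hP, pow_eq_pow_mod j hQ]
  have hsurj : Function.Surjective f := by
    intro g
    obtain ⟨i, j, rfl⟩ := exists_normal_form hgen hP hQP g
    exact ⟨_, hf i j⟩
  have hinj : Function.Injective f :=
    ((Nat.bijective_iff_surjective_and_card f).2
      ⟨hsurj, by rw [Nat.card_prod, Nat.card_fin, hcard]; ring⟩).1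
  have h0 := hinj ((hf i j).trans (h.trans ((hf 0 0).trans (by simp)).symm))
  simp only [Prod.mk.injEq, Fin.mk.injEq, Nat.zero_mod] at h0
  exact ⟨Nat.dvd_of_mod_eq_zero h0.1, Nat.dvd_of_mod_eq_zero h0.2⟩

lemma commute_of_pow_eq_one [Finite G] (hp : p.Prime) (hp2 : p ≠ 2) (hcard : Nat.card G = p ^ 4)
    (hgen : Subgroup.closure ({P, Q} : Set G) = ⊤) (hP : P ^ (p ^ 2) = 1)
    (hQ : Q ^ (p ^ 2) = 1) (hQP : Q⁻¹ * P * Q = P ^ (1 + p)) {g : G} (hg : g ^ p = 1) (h : G) :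
    Commute g h := by
  obtain ⟨i, j, rfl⟩ := exists_normal_form hgen hP hQP g
  obtain ⟨k, l, rfl⟩ := exists_normal_form hgen hP hQP h
  obtain ⟨c, hc⟩ : p ∣ p.choose 2 :=
    hp.dvd_choose_self two_ne_zero (lt_of_le_of_ne hp.two_le (Ne.symm hp2))
  have e : i * p + p * (i * j * (p * c)) = i * p + p ^ 2 * (i * j * c) := by ring
  rw [pow_normal_form hP hQP, hc, e, pow_add, pow_mul P (p ^ 2), hP, one_pow, mul_one] at hg
  obtain ⟨hi, hj⟩ := dvd_of_normal_form_eq_one hp.pos hcard hgen hP hQ hQP hg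
  rw [sq] at hi hj
  obtain ⟨i, rfl⟩ := Nat.dvd_of_mul_dvd_mul_right hp.pos hi
  obtain ⟨j, rfl⟩ := Nat.dvd_of_mul_dvd_mul_right hp.pos hj
  show _ * _ = _ * _
  rw [mul_normal_form hP hQP, mul_normal_form hP hQP, add_comm l,
    show p * i + k + p * (p * i * l) = p * i + k + p ^ 2 * (i * l) by ring,
    show k + p * i + p * (k * (p * j)) = p * i + k + p ^ 2 * (k * j) by ring,
    pow_add P _ (p ^ 2 * _), pow_add P _ (p ^ 2 * _), pow_mul P (p ^ 2), pow_mul P (p ^ 2), hP,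
    one_pow, one_pow]

end GroupVIII

open Brace in
/-- braces of cardinality p^4 with additive group C_{p^2} × C_{p^2} and
multiplicative group VIII are right nilpotent. -/
theorem braceVIII_right_nilpotent (p : ℕ) (hp : p.Prime) (hp5 : 5 < p)
    (A : Type*) [Brace A] (hcard : Nat.card A = p ^ 4)
    (hadd : Nonempty (A ≃+ ZMod (p ^ 2) × ZMod (p ^ 2)))
    (P Q : A) (hgen : Subgroup.closure ({P, Q} : Set A) = ⊤)
    (hP : P ^ (p ^ 2) = 1) (hQ : Q ^ (p ^ 2) = 1)
    (hQP : Q⁻¹ * P * Q = P ^ (1 + p)) :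
    Brace.RightNilpotent A := by
  have hp2 : p ≠ 2 := by omega
  have : Finite A := Nat.finite_of_card_ne_zero (hcard ▸ pow_ne_zero 4 hp.ne_zero)
  obtain ⟨e⟩ := hadd
  set N : AddSubgroup A := (nsmulAddMonoidHom (α := A) p).range
  have hN : LamStable N := lamStable_range_nsmul p
  have hmem : ∀ x : A, p • x ∈ N := fun x => ⟨x, rfl⟩
  have hzero : ∀ x ∈ N, p • x = 0 := by
    rintro _ ⟨y, rfl⟩
    apply e.injective
    have h : ((p : ZMod (p ^ 2)) * p) = 0 := by
      rw [← pow_two]; exact_mod_cast ZMod.natCast_self (p ^ 2)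
    ext <;> simp [← mul_assoc, h]
  have hfix : ∀ a b : A, bstar a b ∈ fixedMod N :=
    hN.bstar_mem_fixedMod hp hcard (index_range_nsmul_le hp e)
  have hann : ∀ a b : A, ∀ x ∈ N, bstar a (bstar b x) = 0 := by
    rintro a b _ ⟨y, rfl⟩
    rw [nsmulAddMonoidHom_apply, bstar_nsmul, bstar_nsmul]
    exact hzero _ (hfix b y a)
  have hcomm : ∀ x ∈ N, ∀ b : A, bstar x b = bstar b x := fun x hx b =>
    bstar_comm_of_commute <| commute_of_pow_eq_one hp hp2 hcard hgen hP hQ hQP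
      (by
        have := lamStable_bot.pow_mem hp hp2 (a := x) (by simpa using hzero x hx)
          (by simpa using hann x x x hx)
        rw [one_eq_zero]; simpa using this) b
  have hcommMod : ∀ a b : A, bstar a b - bstar b a ∈ N := by
    intro a b
    obtain ⟨n, hn⟩ := exists_mul_eq_mul_pow hp.pos hgen hP hQP a b
    have hz : P ^ p ∈ N := hN.pow_mem hp hp2 (hmem P) (hfix P P P)
    have h : bstar a b - bstar b a = lam (b * a) ((P ^ p) ^ n) := by
      rw [bstar, bstar, hn, mul_eq_add_lam (b * a)]; abel
    rw [h]
    exact hN _ _ (hN.pow_mem_of_mem hz n)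
  have h1 : rightSeries A 1 ≤ fixedMod N := starSpan_le fun x _ y _ => hfix x y
  have h2 : rightSeries A 2 ≤ N := starSpan_le fun x hx y _ =>
    by
    simpa using N.add_mem (hcommMod x y) (h1 hx y)
  have h3 : rightSeries A 3 ≤ (fixedMod N).map (nsmulAddMonoidHom (α := A) p) :=
    starSpan_le fun x hx y _ => by
      rw [hcomm x (h2 hx) y]
      obtain ⟨z, rfl⟩ := h2 hx
      exact ⟨bstar y z, hfix y z, (bstar_nsmul p y z).symm⟩
  refine ⟨4, le_bot_iff.1 (starSpan_le fun x hx y _ => ?_)⟩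
  obtain ⟨z, hz, rfl⟩ := h3 hx
  rw [hcomm _ ⟨z, rfl⟩ y, AddSubgroup.mem_bot]
  exact (bstar_nsmul p y z).trans (hzero _ (hz y))
end
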